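/- Let P ⊆ ℝ^d be a centrally symmetric simplicial reflexive polytope. If d is even, then |V(P)| ≤ 3d, with equality if and only if P* is unimodularly equivalent to the (d/2)-fold product Z₂ × ⋯ × Z₂, where Z₂ := conv(±(1,0), ±(0,1), ±(1,1)) ⊆ ℝ². If d is odd, then |V(P)| ≤ 3d − 1, with equality if and only if P* is unimodularly equivalent to [−1,1] × Z₂ × ⋯ × Z₂ with (d−1)/2 factors Z₂. -/

import Mathlib

open scoped BigOperators

noncomputable section

/-- The standard dot product on `ℝ^d`. -/
def dotProd {d : ℕ} (x y : Fin d → ℝ) : ℝ := ∑ i, x i * y i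

/-- A point of `ℝ^d` is a lattice point (element of `ℤ^d`) if all coordinates are integers. -/
def IsLatticePoint {d : ℕ} (x : Fin d → ℝ) : Prop := ∀ i, ∃ n : ℤ, x i = (n : ℝ)

/-- A lattice polytope is the convex hull of finitely many lattice points. -/
def IsLatticePolytope {d : ℕ} (P : Set (Fin d → ℝ)) : Prop :=
  ∃ V : Finset (Fin d → ℝ), (∀ v ∈ V, IsLatticePoint v) ∧ P = convexHull ℝ (V : Set (Fin d → ℝ))

/-- The dual polytope `P* = {y | ⟨x,y⟩ ≥ -1 ∀ x ∈ P}`. -/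
def dualPolytope {d : ℕ} (P : Set (Fin d → ℝ)) : Set (Fin d → ℝ) :=
  {y | ∀ x ∈ P, -1 ≤ dotProd x y}

/-- A reflexive polytope: a full-dimensional lattice polytope with `0` in its interior whose
dual polytope is again a lattice polytope. -/
def IsReflexive {d : ℕ} (P : Set (Fin d → ℝ)) : Prop :=
  IsLatticePolytope P ∧ (0 : Fin d → ℝ) ∈ interior P ∧ IsLatticePolytope (dualPolytope P)

/-- A face of `P`: the subset of `P` where some linear functional attains its maximum bound. -/
def IsFace {d : ℕ} (P F : Set (Fin d → ℝ)) : Prop :=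
  ∃ (u : Fin d → ℝ) (c : ℝ), (∀ x ∈ P, dotProd u x ≤ c) ∧ F = {x ∈ P | dotProd u x = c}

/-- A facet of a `d`-dimensional polytope: a nonempty face of dimension `d - 1`. -/
def IsFacet {d : ℕ} (P F : Set (Fin d → ℝ)) : Prop :=
  IsFace P F ∧ F.Nonempty ∧ Module.finrank ℝ (vectorSpan ℝ F) = d - 1

/-- `x ∼ y` : `x` and `y` lie in a common facet of `P`. -/
def SameFacet {d : ℕ} (P : Set (Fin d → ℝ)) (x y : Fin d → ℝ) : Prop :=
  ∃ F, IsFacet P F ∧ x ∈ F ∧ y ∈ F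

/-- The star set of `x`: the union of all facets of `P` containing `x`. -/
def starSet {d : ℕ} (P : Set (Fin d → ℝ)) (x : Fin d → ℝ) : Set (Fin d → ℝ) :=
  {y | SameFacet P x y}

/-- A family of lattice points forming a `ℤ`-basis of the lattice `ℤ^d`. -/
def IsZBasisFamily {d n : ℕ} (s : Fin n → (Fin d → ℝ)) : Prop :=
  LinearIndependent ℝ s ∧ (∀ i, IsLatticePoint (s i)) ∧
    ∀ z : Fin d → ℝ, IsLatticePoint z → ∃ c : Fin n → ℤ, z = ∑ i, (c i : ℝ) • s i

/-- A primitive lattice point: a nonzero lattice point such that no lattice point lies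
strictly between `0` and it. -/
def IsPrimitivePoint {d : ℕ} (x : Fin d → ℝ) : Prop :=
  IsLatticePoint x ∧ x ≠ 0 ∧ ∀ y ∈ openSegment ℝ (0 : Fin d → ℝ) x, ¬ IsLatticePoint y

/-- A Fano polytope: a full-dimensional lattice polytope with `0` in its interior all of whose
vertices are primitive lattice points. -/
def IsFanoPolytope {d : ℕ} (P : Set (Fin d → ℝ)) : Prop :=
  IsLatticePolytope P ∧ (0 : Fin d → ℝ) ∈ interior P ∧
    ∀ v ∈ Set.extremePoints ℝ P, IsPrimitivePoint v

/-- Canonical: the only interior lattice point is the origin. -/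
def IsCanonicalPolytope {d : ℕ} (P : Set (Fin d → ℝ)) : Prop :=
  {x ∈ interior P | IsLatticePoint x} = {0}

/-- Terminal: the only lattice points of `P` are the origin and the vertices. -/
def IsTerminalPolytope {d : ℕ} (P : Set (Fin d → ℝ)) : Prop :=
  {x ∈ P | IsLatticePoint x} = insert (0 : Fin d → ℝ) (Set.extremePoints ℝ P)

/-- Simplicial: every facet has exactly `d` vertices. -/
def IsSimplicial {d : ℕ} (P : Set (Fin d → ℝ)) : Prop :=
  ∀ F, IsFacet P F → (Set.extremePoints ℝ F).ncard = d

/-- Smooth: the vertices of every facet form a `ℤ`-basis of the lattice. -/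
def IsSmoothPolytope {d : ℕ} (P : Set (Fin d → ℝ)) : Prop :=
  ∀ F, IsFacet P F → ∃ s : Fin d → (Fin d → ℝ),
    Set.extremePoints ℝ F = Set.range s ∧ IsZBasisFamily s

/-- Semi-terminal: any two distinct vertices in a common facet are joined by a lattice-point
free segment. -/
def IsSemiTerminal {d : ℕ} (P : Set (Fin d → ℝ)) : Prop :=
  ∀ v ∈ Set.extremePoints ℝ P, ∀ w ∈ Set.extremePoints ℝ P, v ≠ w → SameFacet P v w →
    {x ∈ segment ℝ v w | IsLatticePoint x} = {v, w}

/-- The quotient space `ℝ^d / ℝv`. -/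
abbrev QuotSpace {d : ℕ} (v : Fin d → ℝ) := (Fin d → ℝ) ⧸ (Submodule.span ℝ {v})

/-- The canonical projection `π_v : ℝ^d → ℝ^d/ℝv`. -/
def projAlong {d : ℕ} (v : Fin d → ℝ) : (Fin d → ℝ) →ₗ[ℝ] QuotSpace v :=
  (Submodule.span ℝ {v}).mkQ

/-- The quotient lattice `ℤ^d/ℤv`, regarded as the image of `ℤ^d` in `ℝ^d/ℝv`. -/
def quotLattice {d : ℕ} (v : Fin d → ℝ) : Set (QuotSpace v) :=
  projAlong v '' {x | IsLatticePoint x}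

/-- A primitive point of the quotient lattice `ℤ^d/ℤv`. -/
def QuotPrimitive {d : ℕ} (v : Fin d → ℝ) (q : QuotSpace v) : Prop :=
  q ∈ quotLattice v ∧ q ≠ 0 ∧ ∀ t ∈ openSegment ℝ (0 : QuotSpace v) q, t ∉ quotLattice v

/-- A Fano polytope in the quotient space `ℝ^d/ℝv` with respect to the lattice `ℤ^d/ℤv`. -/
def QuotIsFanoPolytope {d : ℕ} (v : Fin d → ℝ) (Q : Set (QuotSpace v)) : Prop :=
  (∃ V : Finset (QuotSpace v), (∀ q ∈ V, q ∈ quotLattice v) ∧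
      Q = convexHull ℝ (V : Set (QuotSpace v))) ∧
  (0 : QuotSpace v) ∈ interior Q ∧
  ∀ q ∈ Set.extremePoints ℝ Q, QuotPrimitive v q

/-- Unimodular equivalence: a real linear isomorphism mapping lattice onto lattice and one
polytope onto the other. -/
def LatticeEquivTo {d e : ℕ} (P : Set (Fin d → ℝ)) (Q : Set (Fin e → ℝ)) : Prop :=
  ∃ f : (Fin d → ℝ) ≃ₗ[ℝ] (Fin e → ℝ),
    (∀ x, IsLatticePoint x ↔ IsLatticePoint (f x)) ∧ f '' P = Q

/-- The hexagon `Z₂ = conv(±(1,0), ±(0,1), ±(1,1)) ⊆ ℝ²`. -/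
def Z2 : Set (Fin 2 → ℝ) :=
  convexHull ℝ ({![1,0], ![0,1], ![1,1], ![-1,0], ![0,-1], ![-1,-1]} : Set (Fin 2 → ℝ))

/-- The `j`-th coordinate pair of a point of `ℝ^{2m}`. -/
def pairCoords {m : ℕ} (x : Fin (2 * m) → ℝ) (j : Fin m) : Fin 2 → ℝ :=
  fun i => x ⟨2 * (j : ℕ) + (i : ℕ), by have := j.isLt; have := i.isLt; omega⟩

/-- The `m`-fold product `Z₂ × ⋯ × Z₂ ⊆ ℝ^{2m}`. -/
def prodZ2 (m : ℕ) : Set (Fin (2 * m) → ℝ) := {x | ∀ j : Fin m, pairCoords x j ∈ Z2}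

/-- The `j`-th coordinate pair of a point of `ℝ^{2m+1}` (first `2m` coordinates). -/
def pairCoords' {m : ℕ} (x : Fin (2 * m + 1) → ℝ) (j : Fin m) : Fin 2 → ℝ :=
  fun i => x ⟨2 * (j : ℕ) + (i : ℕ), by have := j.isLt; have := i.isLt; omega⟩

/-- The product `[-1,1] × Z₂ × ⋯ × Z₂ ⊆ ℝ^{2m+1}` with `m` hexagon factors. -/
def boxProdZ2 (m : ℕ) : Set (Fin (2 * m + 1) → ℝ) :=
  {x | x ⟨2 * m, by omega⟩ ∈ Set.Icc (-1 : ℝ) 1 ∧ ∀ j : Fin m, pairCoords' x j ∈ Z2}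

section LatticePoints

lemma dotProd_eq_dotProduct {d : ℕ} (x y : Fin d → ℝ) : dotProd x y = x ⬝ᵥ y := rfl

lemma IsLatticePoint.sub {d : ℕ} {x y : Fin d → ℝ} (hx : IsLatticePoint x)
    (hy : IsLatticePoint y) : IsLatticePoint (x - y) := fun i => by
  obtain ⟨n, hn⟩ := hx i
  obtain ⟨k, hk⟩ := hy i
  exact ⟨n - k, by simp [hn, hk]⟩

lemma IsLatticePoint.sum_intCast_smul {d : ℕ} {ι : Type*} (s : Finset ι) (x : ι → Fin d → ℝ)
    (c : ι → ℤ) (hx : ∀ i ∈ s, IsLatticePoint (x i)) :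
    IsLatticePoint (∑ i ∈ s, (c i : ℝ) • x i) := by
  intro j
  choose! n hn using fun i hi => hx i hi j
  refine ⟨∑ i ∈ s, c i * n i, ?_⟩
  push_cast
  rw [Finset.sum_apply]
  exact Finset.sum_congr rfl fun i hi => by simp [hn i hi]

lemma IsLatticePoint.sum {d : ℕ} {ι : Type*} (s : Finset ι) (x : ι → Fin d → ℝ)
    (hx : ∀ i ∈ s, IsLatticePoint (x i)) : IsLatticePoint (∑ i ∈ s, x i) := by
  simpa using IsLatticePoint.sum_intCast_smul s x (fun _ => 1) hx

lemma IsLatticePoint.exists_dotProduct_eq {d : ℕ} {x y : Fin d → ℝ} (hx : IsLatticePoint x)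
    (hy : IsLatticePoint y) : ∃ n : ℤ, x ⬝ᵥ y = n := by
  choose n hn using hx
  choose k hk using hy
  exact ⟨∑ i, n i * k i, by simp [dotProduct, hn, hk]⟩

end LatticePoints

section DualBasis

lemma exists_dotProduct_eq_apply {d : ℕ} (f : (Fin d → ℝ) →ₗ[ℝ] ℝ) :
    ∃ y : Fin d → ℝ, ∀ x, x ⬝ᵥ y = f x := by
  refine ⟨fun i => f fun j => if i = j then 1 else 0, fun x => ?_⟩
  rw [LinearMap.pi_apply_eq_sum_univ f x]
  rfl

/-- The `i`-th vector of the basis dual to `b` with respect to the dot product. -/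
def dualVec {d : ℕ} (b : Module.Basis (Fin d) ℝ (Fin d → ℝ)) (i : Fin d) : Fin d → ℝ :=
  (exists_dotProduct_eq_apply (b.coord i)).choose

@[simp]
lemma dotProduct_dualVec {d : ℕ} (b : Module.Basis (Fin d) ℝ (Fin d → ℝ)) (i : Fin d)
    (x : Fin d → ℝ) : x ⬝ᵥ dualVec b i = b.repr x i :=
  (exists_dotProduct_eq_apply (b.coord i)).choose_spec x

lemma dotProduct_eq_sum_repr {d : ℕ} (b : Module.Basis (Fin d) ℝ (Fin d → ℝ))
    (x y : Fin d → ℝ) : x ⬝ᵥ y = ∑ i, b.repr x i * (b i ⬝ᵥ y) := by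
  conv_lhs => rw [← b.sum_repr x, sum_dotProduct]
  simp only [smul_dotProduct, smul_eq_mul]

lemma eq_of_forall_dotProduct_eq {d : ℕ} {y z : Fin d → ℝ} (h : ∀ x, x ⬝ᵥ y = x ⬝ᵥ z) :
    y = z :=
  dotProduct_eq _ _ fun u => by rw [dotProduct_comm, h, dotProduct_comm]

lemma eq_of_forall_basis_dotProduct_eq {d : ℕ} (b : Module.Basis (Fin d) ℝ (Fin d → ℝ))
    {y z : Fin d → ℝ} (h : ∀ i, b i ⬝ᵥ y = b i ⬝ᵥ z) : y = z :=
  eq_of_forall_dotProduct_eq fun x => by simp only [dotProduct_eq_sum_repr b x, h]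

lemma sum_dotProduct_smul_dualVec {d : ℕ} (b : Module.Basis (Fin d) ℝ (Fin d → ℝ))
    (y : Fin d → ℝ) : ∑ i, (b i ⬝ᵥ y) • dualVec b i = y :=
  eq_of_forall_dotProduct_eq fun x => by
    rw [dotProduct_eq_sum_repr b x y]
    simp [dotProduct_sum, mul_comm]

/-- Evaluation at the vectors of a basis, as a linear equivalence. -/
def dotEquiv {d : ℕ} (b : Module.Basis (Fin d) ℝ (Fin d → ℝ)) :
    (Fin d → ℝ) ≃ₗ[ℝ] (Fin d → ℝ) where
  toFun y i := b i ⬝ᵥ y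
  map_add' y z := by ext i; simp
  map_smul' c y := by ext i; simp
  invFun z := ∑ i, z i • dualVec b i
  left_inv y := sum_dotProduct_smul_dualVec b y
  right_inv z := by
    ext j
    simp [dotProduct_sum, Finsupp.single_apply]

@[simp]
lemma dotEquiv_apply {d : ℕ} (b : Module.Basis (Fin d) ℝ (Fin d → ℝ)) (y : Fin d → ℝ)
    (i : Fin d) : dotEquiv b y i = b i ⬝ᵥ y := rfl

lemma isLatticePoint_dotEquiv_iff {d : ℕ} (b : Module.Basis (Fin d) ℝ (Fin d → ℝ))
    (hb : ∀ i, IsLatticePoint (b i)) (hb' : ∀ i, IsLatticePoint (dualVec b i))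
    (y : Fin d → ℝ) : IsLatticePoint y ↔ IsLatticePoint (dotEquiv b y) := by
  refine ⟨fun hy i => (hb i).exists_dotProduct_eq hy, fun hy => ?_⟩
  choose n hn using hy
  simp only [dotEquiv_apply] at hn
  rw [← sum_dotProduct_smul_dualVec b y]
  simp only [hn]
  exact IsLatticePoint.sum_intCast_smul _ _ _ fun i _ => hb' i

end DualBasis

section Polar

/-- The polar of a set, with the sign convention `v ⬝ᵥ y ≤ 1`. -/
def polarSet {d : ℕ} (V : Set (Fin d → ℝ)) : Set (Fin d → ℝ) := {y | ∀ v ∈ V, v ⬝ᵥ y ≤ 1}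

/-- The elements of `V` whose inequality is tight at `u`. -/
def tightSet {d : ℕ} (V : Set (Fin d → ℝ)) (u : Fin d → ℝ) : Set (Fin d → ℝ) :=
  {v ∈ V | v ⬝ᵥ u = 1}

/-- The elements of `V` on the hyperplane orthogonal to `u`. -/
def levelZero {d : ℕ} (V : Set (Fin d → ℝ)) (u : Fin d → ℝ) : Set (Fin d → ℝ) :=
  {v ∈ V | v ⬝ᵥ u = 0}

/-- The indices of the negative coordinates of `v` with respect to `b`. -/
def negSupport {d : ℕ} (b : Module.Basis (Fin d) ℝ (Fin d → ℝ)) (v : Fin d → ℝ) :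
    Finset (Fin d) := Finset.univ.filter fun i => b.repr v i < 0

lemma mem_negSupport {d : ℕ} {b : Module.Basis (Fin d) ℝ (Fin d → ℝ)} {v : Fin d → ℝ}
    {i : Fin d} : i ∈ negSupport b v ↔ b.repr v i < 0 := by simp [negSupport]

lemma eq_zero_of_forall_tightSet {d : ℕ} {V : Set (Fin d → ℝ)} (hV : V.Finite)
    {u : Fin d → ℝ} (hu : u ∈ Set.extremePoints ℝ (polarSet V)) {y : Fin d → ℝ}
    (hy : ∀ v ∈ tightSet V u, v ⬝ᵥ y = 0) : y = 0 := by
  have key : ∀ z : Fin d → ℝ, (∀ v ∈ tightSet V u, v ⬝ᵥ z = 0) →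
      ∀ᶠ ε : ℝ in nhdsWithin 0 (Set.Ioi 0), u + ε • z ∈ polarSet V := by
    intro z hz
    have : ∀ᶠ ε : ℝ in nhdsWithin 0 (Set.Ioi 0), ∀ v ∈ V, v ⬝ᵥ (u + ε • z) ≤ 1 := by
      rw [Filter.eventually_all_finite hV]
      intro v hv
      rcases (hu.1 v hv).eq_or_lt with h | h
      · refine Filter.Eventually.of_forall fun ε => ?_
        simp [h, hz v ⟨hv, h⟩]
      · have hcont : Continuous fun ε : ℝ => v ⬝ᵥ (u + ε • z) := by
          simp only [dotProduct_add, dotProduct_smul, smul_eq_mul]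
          fun_prop
        have h0 := hcont.tendsto 0
        simp only [zero_smul, add_zero] at h0
        exact ((h0.eventually (gt_mem_nhds h)).mono fun ε hε => hε.le).filter_mono
          nhdsWithin_le_nhds
    exact this
  obtain ⟨ε, ⟨h1, h2⟩, hε⟩ := (((key y hy).and (key (-y) fun v hv => by simp [hy v hv])).and
    self_mem_nhdsWithin).exists
  have hseg : u ∈ openSegment ℝ (u + ε • y) (u + ε • -y) :=
    ⟨1 / 2, 1 / 2, by norm_num, by norm_num, by norm_num, by module⟩
  have := (mem_extremePoints.1 hu).2 _ h1 _ h2 hseg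
  have h3 : ε • y = 0 := by simpa using this.1
  exact (smul_eq_zero.1 h3).resolve_left (ne_of_gt hε)

lemma span_tightSet {d : ℕ} {V : Set (Fin d → ℝ)} (hV : V.Finite)
    {u : Fin d → ℝ} (hu : u ∈ Set.extremePoints ℝ (polarSet V)) :
    Submodule.span ℝ (tightSet V u) = ⊤ := by
  by_contra h
  obtain ⟨f, hf, hle⟩ := Submodule.exists_le_ker_of_lt_top _ (lt_top_iff_ne_top.2 h)
  obtain ⟨y, hy⟩ := exists_dotProduct_eq_apply f
  have hy0 : y = 0 := eq_zero_of_forall_tightSet hV hu fun v hv => by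
    rw [hy]
    exact hle (Submodule.subset_span hv)
  refine hf (LinearMap.ext fun x => ?_)
  rw [← hy x, hy0]
  simp

lemma eq_of_mem_openSegment_of_dotProduct_le {d : ℕ} {v x y z : Fin d → ℝ} {c : ℝ}
    (hx : v ⬝ᵥ x ≤ c) (hy : v ⬝ᵥ y ≤ c) (hz : z ∈ openSegment ℝ x y) (h : v ⬝ᵥ z = c) :
    v ⬝ᵥ x = c := by
  obtain ⟨s, t, hs, ht, hst, rfl⟩ := hz
  simp only [dotProduct_add, dotProduct_smul, smul_eq_mul] at h
  refine le_antisymm hx ?_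
  obtain rfl : t = 1 - s := by linarith
  by_contra! hlt
  nlinarith [mul_lt_mul_of_pos_left hlt hs, mul_le_mul_of_nonneg_left hy ht.le]

lemma mem_extremePoints_polarSet {d : ℕ} {V : Set (Fin d → ℝ)} {u : Fin d → ℝ}
    (hu : u ∈ polarSet V) (h : ∀ y, (∀ v ∈ tightSet V u, v ⬝ᵥ y = 0) → y = 0) :
    u ∈ Set.extremePoints ℝ (polarSet V) := by
  refine mem_extremePoints_iff_left.2 ⟨hu, fun x hx y hy hseg => sub_eq_zero.1 (h _ fun v hv => ?_)⟩
  rw [dotProduct_sub, hv.2,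
    eq_of_mem_openSegment_of_dotProduct_le (hx v hv.1) (hy v hv.1) hseg hv.2, sub_self]

end Polar

section Pairing

/-- The first index of the `k`-th pair of coordinates. -/
def evenIdx {m d : ℕ} (hm : 2 * m ≤ d) (k : Fin m) : Fin d := ⟨2 * k, by omega⟩

/-- The second index of the `k`-th pair of coordinates. -/
def oddIdx {m d : ℕ} (hm : 2 * m ≤ d) (k : Fin m) : Fin d := ⟨2 * k + 1, by omega⟩

/-- The product of `m` hexagons and a cube of dimension `d - 2 * m`. -/
def hexBox {m d : ℕ} (hm : 2 * m ≤ d) : Set (Fin d → ℝ) :=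
  {z | (∀ i, |z i| ≤ 1) ∧ ∀ k : Fin m, |z (evenIdx hm k) - z (oddIdx hm k)| ≤ 1}

lemma exists_finset_half {α β : Type*} [DecidableEq α] [InvolutiveNeg α] [LinearOrder β]
    (L : Finset α) (ν : α → β) (hinj : Set.InjOn ν L) (hneg : ∀ v ∈ L, -v ∈ L)
    (hne : ∀ v ∈ L, v ≠ -v) :
    ∃ H ⊆ L, 2 * H.card = L.card ∧ (∀ v ∈ H, -v ∉ H) ∧ ∀ v ∈ L, v ∈ H ∨ -v ∈ H := by
  have hH : ∀ v ∈ L, ν v < ν (-v) ∨ ν (-v) < ν v := fun v hv =>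
    lt_or_gt_of_ne fun h => hne v hv (hinj hv (hneg v hv) h)
  have himg : (L.filter fun v => ¬ ν v < ν (-v)) =
      (L.filter fun v => ν v < ν (-v)).image fun v => -v := by
    ext v
    simp only [Finset.mem_filter, Finset.mem_image, not_lt]
    constructor
    · rintro ⟨hv, h⟩
      refine ⟨-v, ⟨hneg v hv, ?_⟩, neg_neg v⟩
      rw [neg_neg]
      exact (hH v hv).resolve_left h.not_gt
    · rintro ⟨w, ⟨hw, h⟩, rfl⟩
      refine ⟨hneg w hw, ?_⟩
      rw [neg_neg]
      exact h.le
  refine ⟨L.filter fun v => ν v < ν (-v), Finset.filter_subset _ _, ?_, ?_, ?_⟩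
  · rw [← Finset.card_filter_add_card_filter_not (s := L) fun v => ν v < ν (-v), himg,
      Finset.card_image_of_injective _ neg_injective, two_mul]
  · intro v hv hv'
    simp only [Finset.mem_filter, neg_neg] at hv hv'
    exact lt_asymm hv.2 hv'.2
  · intro v hv
    simp only [Finset.mem_filter, neg_neg]
    exact (hH v hv).imp (fun h => ⟨hv, h⟩) fun h => ⟨hneg v hv, h⟩

lemma exists_perm_pairing {α : Type*} [InvolutiveNeg α] {m d : ℕ} (hm : 2 * m ≤ d)
    (L : Finset α) (hL : L.card = 2 * m) (ν : α → Fin d) (hinj : Set.InjOn ν L)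
    (hneg : ∀ v ∈ L, -v ∈ L) (hne : ∀ v ∈ L, v ≠ -v) :
    ∃ (σ : Fin d ≃ Fin d) (h : Fin m → α), (∀ k, h k ∈ L) ∧
      (∀ k, σ (evenIdx hm k) = ν (-h k)) ∧ (∀ k, σ (oddIdx hm k) = ν (h k)) ∧
      ∀ v ∈ L, ∃ k, v = h k ∨ v = -h k := by
  classical
  obtain ⟨H, hHL, hHcard, hHneg, hHor⟩ := exists_finset_half L ν hinj hneg hne
  let e : Fin m ≃ H := (H.equivFinOfCardEq (by omega)).symm
  let g : (i : ℕ) → i < 2 * m → α := fun i hi =>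
    if i % 2 = 0 then -(e ⟨i / 2, by omega⟩ : α) else e ⟨i / 2, by omega⟩
  have hgL : ∀ i hi, g i hi ∈ L := fun i hi => by
    simp only [g]
    split_ifs
    · exact hneg _ (hHL (e _).2)
    · exact hHL (e _).2
  have hginj : ∀ i j hi hj, g i hi = g j hj → i = j := fun i j hi hj hij => by
    simp only [g] at hij
    split_ifs at hij
    · have := congrArg Fin.val (e.injective (Subtype.ext (neg_injective hij)))
      simp only at this
      omega
    · exact absurd (hij ▸ (e _).2) (hHneg _ (e _).2)
    · exact absurd (hij ▸ (e _).2) (hHneg _ (e _).2)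
    · have := congrArg Fin.val (e.injective (Subtype.ext hij))
      simp only at this
      omega
  let f : Fin d → Fin d := fun i => if hi : (i : ℕ) < 2 * m then ν (g i hi) else i
  have hf : ∀ (i : Fin d) (hi : (i : ℕ) < 2 * m), f i = ν (g i hi) := fun i hi => dif_pos hi
  obtain ⟨σ, hσ⟩ := Finset.exists_equiv_extend_of_card_eq (α := Fin d)
    (t := (Finset.univ : Finset (Fin d))) (by simp)
    (s := Finset.univ.filter fun i : Fin d => (i : ℕ) < 2 * m) (f := f)
    (Finset.subset_univ _) (by
      intro i hi j hj hij
      simp only [Finset.coe_filter, Finset.mem_univ, true_and, Set.mem_ofPred_eq] at hi hj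
      rw [hf i hi, hf j hj] at hij
      exact Fin.ext (hginj _ _ hi hj (hinj (hgL _ hi) (hgL _ hj) hij)))
  refine ⟨σ.trans (Equiv.subtypeUnivEquiv Finset.mem_univ), fun k => e k,
    fun k => hHL (e k).2, fun k => ?_, fun k => ?_, fun v hv => ?_⟩
  · have hk : ((evenIdx hm k : Fin d) : ℕ) < 2 * m := by
      simp only [evenIdx]
      omega
    have := hσ (evenIdx hm k) (by simpa using hk)
    rw [hf _ hk] at this
    refine this.trans ?_
    simp [g, evenIdx]
  · have hk : ((oddIdx hm k : Fin d) : ℕ) < 2 * m := by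
      simp only [oddIdx]
      omega
    have := hσ (oddIdx hm k) (by simpa using hk)
    rw [hf _ hk] at this
    have h2 : (2 * (k : ℕ) + 1) / 2 = k := by omega
    refine this.trans ?_
    simp [g, oddIdx, h2]
  · rcases hHor v hv with h | h
    · exact ⟨e.symm ⟨v, h⟩, Or.inl (by simp)⟩
    · exact ⟨e.symm ⟨-v, h⟩, Or.inr (by simp)⟩

end Pairing

section Core

/-- The properties of the vertex set of a centrally symmetric simplicial reflexive polytope
that are used for counting its elements. -/
structure IsSymmetricReflexiveSystem {d : ℕ} (V : Set (Fin d → ℝ)) : Prop where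
  finite : V.Finite
  neg_mem : ∀ v ∈ V, -v ∈ V
  zero_notMem : (0 : Fin d → ℝ) ∉ V
  lattice : ∀ v ∈ V, IsLatticePoint v
  polar_lattice : ∀ u ∈ Set.extremePoints ℝ (polarSet V), IsLatticePoint u
  simplicial : ∀ u ∈ Set.extremePoints ℝ (polarSet V), (tightSet V u).ncard = d

namespace IsSymmetricReflexiveSystem

variable {d : ℕ} {V : Set (Fin d → ℝ)} {u : Fin d → ℝ}

lemma dotProduct_mem_level (hV : IsSymmetricReflexiveSystem V)
    (hu : u ∈ Set.extremePoints ℝ (polarSet V)) {v : Fin d → ℝ} (hv : v ∈ V) :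
    v ⬝ᵥ u = 1 ∨ v ⬝ᵥ u = -1 ∨ v ⬝ᵥ u = 0 := by
  obtain ⟨n, hn⟩ := (hV.lattice v hv).exists_dotProduct_eq (hV.polar_lattice u hu)
  have h1 := hu.1 v hv
  have h2 := hu.1 (-v) (hV.neg_mem v hv)
  rw [neg_dotProduct] at h2
  rw [hn] at h1 h2 ⊢
  have h3 : n ≤ 1 := by exact_mod_cast h1
  have h4 : -n ≤ 1 := by exact_mod_cast h2
  have : n = 1 ∨ n = -1 ∨ n = 0 := by omega
  rcases this with rfl | rfl | rfl <;> simp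

lemma exists_basis (hV : IsSymmetricReflexiveSystem V)
    (hu : u ∈ Set.extremePoints ℝ (polarSet V)) :
    ∃ b : Module.Basis (Fin d) ℝ (Fin d → ℝ), Set.range b = tightSet V u := by
  have hfin : (tightSet V u).Finite := hV.finite.subset fun v hv => hv.1
  have := hfin.to_subtype
  have hcard : Nat.card (tightSet V u) = d := hV.simplicial u hu
  let e := (Finite.equivFinOfCardEq hcard).symm
  have hr : Set.range (fun i => (e i : Fin d → ℝ)) = tightSet V u := by
    rw [show (fun i => (e i : Fin d → ℝ)) = Subtype.val ∘ e from rfl, e.surjective.range_comp]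
    exact Subtype.range_coe
  refine ⟨basisOfTopLeSpanOfCardEqFinrank (fun i => (e i : Fin d → ℝ)) ?_ (by simp), ?_⟩
  · rw [hr, span_tightSet hV.finite hu]
  · rw [coe_basisOfTopLeSpanOfCardEqFinrank, hr]

variable {b : Module.Basis (Fin d) ℝ (Fin d → ℝ)}

lemma basis_mem (hb : Set.range b = tightSet V u) (i : Fin d) : b i ∈ V :=
  (hb ▸ Set.mem_range_self i : b i ∈ tightSet V u).1

lemma basis_dotProduct (hb : Set.range b = tightSet V u) (i : Fin d) : b i ⬝ᵥ u = 1 :=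
  (hb ▸ Set.mem_range_self i : b i ∈ tightSet V u).2

lemma dotProduct_eq_sum_coord (hb : Set.range b = tightSet V u) (x : Fin d → ℝ) :
    x ⬝ᵥ u = ∑ i, b.repr x i := by
  simp [dotProduct_eq_sum_repr b x u, basis_dotProduct hb]

/-- Crossing the ridge opposite to `b i` leads to a vertex of the polar whose facet has exactly
one vertex outside that ridge. -/
lemma exists_adjacent (hV : IsSymmetricReflexiveSystem V)
    (hu : u ∈ Set.extremePoints ℝ (polarSet V)) (hb : Set.range b = tightSet V u) (i : Fin d) :
    ∃ (w : Fin d → ℝ) (s : ℝ), 0 < s ∧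
      u - s • dualVec b i ∈ Set.extremePoints ℝ (polarSet V) ∧
      ∀ v ∈ tightSet V (u - s • dualVec b i), b.repr v i ≠ 0 → v = w := by
  let N : Set (Fin d → ℝ) := {v ∈ V | b.repr v i < 0}
  have hN : N.Finite := hV.finite.subset fun v hv => hv.1
  have hNne : N.Nonempty := ⟨-b i, hV.neg_mem _ (basis_mem hb i), by simp⟩
  obtain ⟨n, hn, hmin⟩ := hN.exists_minimalFor
    (fun v => (1 - v ⬝ᵥ u) / (-b.repr v i)) N hNne
  have hmin' : ∀ v ∈ N, (1 - n ⬝ᵥ u) / (-b.repr n i) ≤ (1 - v ⬝ᵥ u) / (-b.repr v i) :=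
    fun v hv => (le_total _ _).elim id fun h => hmin hv h
  set s := (1 - n ⬝ᵥ u) / (-b.repr n i) with hs
  have hni : b.repr n i < 0 := hn.2
  have hnu : n ⬝ᵥ u < 1 := by
    refine lt_of_le_of_ne (hu.1 n hn.1) fun h => ?_
    obtain ⟨j, rfl⟩ : n ∈ Set.range b := hb ▸ ⟨hn.1, h⟩
    rw [b.repr_self, Finsupp.single_apply] at hni
    split_ifs at hni <;> linarith
  have hspos : 0 < s := div_pos (by linarith) (by linarith)
  have hval : ∀ v, v ⬝ᵥ (u - s • dualVec b i) = v ⬝ᵥ u - s * b.repr v i := by simp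
  have hntight : n ∈ tightSet V (u - s • dualVec b i) := by
    refine ⟨hn.1, ?_⟩
    have := hni.ne
    rw [hval, hs]
    field_simp
    ring
  have hbtight : ∀ j, j ≠ i → b j ∈ tightSet V (u - s • dualVec b i) := fun j hj =>
    ⟨basis_mem hb j, by simp [hval, basis_dotProduct hb, hj]⟩
  have hext : u - s • dualVec b i ∈ Set.extremePoints ℝ (polarSet V) := by
    refine mem_extremePoints_polarSet (fun v hv => ?_) fun y hy => ?_
    · rw [hval]
      rcases le_or_gt 0 (b.repr v i) with h | h
      · have := hu.1 v hv
        have := mul_nonneg hspos.le h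
        linarith
      · have := hmin' v ⟨hv, h⟩
        rw [le_div_iff₀ (by linarith)] at this
        linarith
    · have h1 := dotProduct_eq_sum_repr b n y
      rw [hy n hntight, Finset.sum_eq_single i
        (fun j _ hj => by rw [hy _ (hbtight j hj), mul_zero]) (by simp)] at h1
      have h2 : b i ⬝ᵥ y = 0 := (mul_eq_zero.1 h1.symm).resolve_left hni.ne
      refine eq_of_forall_basis_dotProduct_eq b fun j => ?_
      rw [dotProduct_zero]
      by_cases hj : j = i
      · rw [hj, h2]
      · exact hy _ (hbtight j hj)
  refine ⟨n, s, hspos, hext, fun v hv hvi => ?_⟩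
  have hinj : Function.Injective (Function.update b i n) := by
    intro j k hjk
    by_cases hj : j = i <;> by_cases hk : k = i
    · rw [hj, hk]
    · subst hj
      simp only [Function.update_self, Function.update_of_ne hk] at hjk
      simp [hjk, hk] at hni
    · subst hk
      simp only [Function.update_self, Function.update_of_ne hj] at hjk
      simp [← hjk, hj] at hni
    · simp only [Function.update_of_ne hk, Function.update_of_ne hj] at hjk
      exact b.injective hjk
  have hsub : Set.range (Function.update b i n) ⊆ tightSet V (u - s • dualVec b i) := by
    rintro _ ⟨j, rfl⟩
    by_cases hj : j = i
    · subst hj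
      simpa using hntight
    · simpa [Function.update_of_ne hj] using hbtight j hj
  have heq := Set.eq_of_subset_of_ncard_le hsub
    (by rw [hV.simplicial _ hext, ← Set.image_univ, Set.ncard_image_of_injective _ hinj]; simp)
    (hV.finite.subset fun v hv => hv.1)
  obtain ⟨j, rfl⟩ : v ∈ Set.range (Function.update b i n) := heq ▸ hv
  by_cases hj : j = i
  · subst hj
    simp
  · simp [hj] at hvi

/-- A vertex on the middle level with a negative `i`-th coordinate is the unique new vertex of
the facet adjacent across the `i`-th ridge. -/
lemma exists_forall_level_zero (hV : IsSymmetricReflexiveSystem V)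
    (hu : u ∈ Set.extremePoints ℝ (polarSet V)) (hb : Set.range b = tightSet V u) (i : Fin d) :
    ∃ w : Fin d → ℝ, ∀ v ∈ V, v ⬝ᵥ u = 0 → b.repr v i < 0 →
      v = w ∧ b.repr v i = -1 ∧ IsLatticePoint (dualVec b i) := by
  obtain ⟨w, s, hs, hext, huniq⟩ := hV.exists_adjacent hu hb i
  have hval : ∀ v, v ⬝ᵥ (u - s • dualVec b i) = v ⬝ᵥ u - s * b.repr v i := by simp
  refine ⟨w, fun v hv hvu hvi => ?_⟩
  have htight : v ⬝ᵥ (u - s • dualVec b i) = 1 := by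
    have hpos : 0 < v ⬝ᵥ (u - s • dualVec b i) := by
      rw [hval, hvu]
      nlinarith
    rcases hV.dotProduct_mem_level hext hv with h | h | h <;> linarith
  have hvw := huniq v ⟨hv, htight⟩ hvi.ne
  have hbi := hV.dotProduct_mem_level hext (basis_mem hb i)
  rw [hval, hvu] at htight
  rw [hval, basis_dotProduct hb] at hbi
  simp only [Module.Basis.repr_self, Finsupp.single_eq_same] at hbi
  have hs1 : s = 1 := by
    rcases hbi with h | h | h
    · linarith
    · exfalso
      have hneg : -b i ∈ tightSet V (u - s • dualVec b i) :=
        ⟨hV.neg_mem _ (basis_mem hb i), by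
          rw [hval, neg_dotProduct, basis_dotProduct hb]
          simp
          linarith⟩
      have h1 := huniq _ hneg (by simp)
      rw [hvw, ← h1, neg_dotProduct, basis_dotProduct hb] at hvu
      norm_num at hvu
    · linarith
  subst hs1
  refine ⟨hvw, by linarith, ?_⟩
  simpa using (hV.polar_lattice u hu).sub (hV.polar_lattice _ hext)

lemma finite_levelZero (hV : IsSymmetricReflexiveSystem V) (u : Fin d → ℝ) :
    (levelZero V u).Finite := hV.finite.subset fun _ hv => hv.1

lemma neg_mem_levelZero (hV : IsSymmetricReflexiveSystem V) {v : Fin d → ℝ}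
    (hv : v ∈ levelZero V u) : -v ∈ levelZero V u :=
  ⟨hV.neg_mem v hv.1, by rw [neg_dotProduct, hv.2, neg_zero]⟩

lemma ne_neg_of_mem (hV : IsSymmetricReflexiveSystem V) {v : Fin d → ℝ} (hv : v ∈ V) :
    v ≠ -v := fun h => hV.zero_notMem ((self_eq_neg (a := v)).1 h ▸ hv)

lemma eq_union (hV : IsSymmetricReflexiveSystem V)
    (hu : u ∈ Set.extremePoints ℝ (polarSet V)) :
    V = (tightSet V u ∪ -tightSet V u) ∪ levelZero V u := by
  ext v
  constructor
  · intro hv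
    rcases hV.dotProduct_mem_level hu hv with h | h | h
    · exact Or.inl (Or.inl ⟨hv, h⟩)
    · exact Or.inl (Or.inr ⟨hV.neg_mem v hv, by rw [neg_dotProduct, h, neg_neg]⟩)
    · exact Or.inr ⟨hv, h⟩
  · rintro ((h | h) | h)
    · exact h.1
    · exact neg_neg v ▸ hV.neg_mem _ h.1
    · exact h.1

lemma ncard_eq (hV : IsSymmetricReflexiveSystem V)
    (hu : u ∈ Set.extremePoints ℝ (polarSet V)) :
    V.ncard = 2 * d + (levelZero V u).ncard := by
  have hT : (tightSet V u).Finite := hV.finite.subset fun _ hv => hv.1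
  have h1 : Disjoint (tightSet V u) (-tightSet V u) := by
    rw [Set.disjoint_left]
    intro v hv hv'
    have h2 := hv'.2
    rw [neg_dotProduct, hv.2] at h2
    norm_num at h2
  have h2 : Disjoint (tightSet V u ∪ -tightSet V u) (levelZero V u) := by
    rw [Set.disjoint_left]
    rintro v (hv | hv) hv'
    · have h3 := hv.2
      rw [hv'.2] at h3
      norm_num at h3
    · have h3 := hv.2
      rw [neg_dotProduct, hv'.2] at h3
      norm_num at h3
  conv_lhs => rw [hV.eq_union hu]
  rw [Set.ncard_union_eq h2 (hT.union hT.neg) (hV.finite_levelZero u),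
    Set.ncard_union_eq h1 hT hT.neg, Set.ncard_neg, hV.simplicial u hu, two_mul]

lemma even_ncard_levelZero (hV : IsSymmetricReflexiveSystem V) (u : Fin d → ℝ) :
    Even (levelZero V u).ncard := by
  rw [Set.ncard_eq_toFinset_card _ (hV.finite_levelZero u), ← ZMod.natCast_eq_zero_iff_even]
  have := Finset.sum_involution (s := (hV.finite_levelZero u).toFinset)
    (f := fun _ => (1 : ZMod 2)) (fun v _ => -v) (fun _ _ => by decide)
    (fun v hv _ h => hV.ne_neg_of_mem ((Set.Finite.mem_toFinset _).1 hv).1 h.symm)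
    (fun v hv => by
      rw [Set.Finite.mem_toFinset] at hv ⊢
      exact hV.neg_mem_levelZero hv)
    (fun v _ => neg_neg v)
  simpa using this

lemma negSupport_inj (hV : IsSymmetricReflexiveSystem V)
    (hu : u ∈ Set.extremePoints ℝ (polarSet V)) (hb : Set.range b = tightSet V u)
    {v w : Fin d → ℝ} (hv : v ∈ levelZero V u) (hw : w ∈ levelZero V u) {i : Fin d}
    (hvi : i ∈ negSupport b v) (hwi : i ∈ negSupport b w) : v = w := by
  obtain ⟨x, hx⟩ := hV.exists_forall_level_zero hu hb i
  rw [(hx v hv.1 hv.2 (mem_negSupport.1 hvi)).1, (hx w hw.1 hw.2 (mem_negSupport.1 hwi)).1]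

lemma repr_eq_neg_one (hV : IsSymmetricReflexiveSystem V)
    (hu : u ∈ Set.extremePoints ℝ (polarSet V)) (hb : Set.range b = tightSet V u)
    {v : Fin d → ℝ} (hv : v ∈ levelZero V u) {i : Fin d} (hvi : i ∈ negSupport b v) :
    b.repr v i = -1 := by
  obtain ⟨x, hx⟩ := hV.exists_forall_level_zero hu hb i
  exact (hx v hv.1 hv.2 (mem_negSupport.1 hvi)).2.1

lemma isLatticePoint_dualVec (hV : IsSymmetricReflexiveSystem V)
    (hu : u ∈ Set.extremePoints ℝ (polarSet V)) (hb : Set.range b = tightSet V u)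
    {v : Fin d → ℝ} (hv : v ∈ levelZero V u) {i : Fin d} (hvi : i ∈ negSupport b v) :
    IsLatticePoint (dualVec b i) := by
  obtain ⟨x, hx⟩ := hV.exists_forall_level_zero hu hb i
  exact (hx v hv.1 hv.2 (mem_negSupport.1 hvi)).2.2

lemma repr_eq_ite_sub_ite (hV : IsSymmetricReflexiveSystem V)
    (hu : u ∈ Set.extremePoints ℝ (polarSet V)) (hb : Set.range b = tightSet V u)
    {v : Fin d → ℝ} (hv : v ∈ levelZero V u) (i : Fin d) :
    b.repr v i = (if i ∈ negSupport b (-v) then 1 else 0) -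
      (if i ∈ negSupport b v then 1 else 0) := by
  have h1 := fun h => hV.repr_eq_neg_one hu hb hv (i := i) h
  have h2 := fun h => hV.repr_eq_neg_one hu hb (hV.neg_mem_levelZero hv) (i := i) h
  simp only [mem_negSupport, map_neg, Finsupp.coe_neg, Pi.neg_apply] at h1 h2 ⊢
  rcases lt_trichotomy (b.repr v i) 0 with h | h | h
  · rw [if_neg (by linarith), if_pos h, h1 h]
    norm_num
  · simp [h]
  · rw [if_pos (by linarith), if_neg (by linarith)]
    linarith [h2 (by linarith)]

lemma card_negSupport_neg (hV : IsSymmetricReflexiveSystem V)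
    (hu : u ∈ Set.extremePoints ℝ (polarSet V)) (hb : Set.range b = tightSet V u)
    {v : Fin d → ℝ} (hv : v ∈ levelZero V u) :
    (negSupport b (-v)).card = (negSupport b v).card := by
  have h := dotProduct_eq_sum_coord hb v
  rw [hv.2, Finset.sum_congr rfl fun i _ => hV.repr_eq_ite_sub_ite hu hb hv i,
    Finset.sum_sub_distrib] at h
  simp only [Finset.sum_ite_mem, Finset.univ_inter, Finset.sum_const, nsmul_eq_mul,
    mul_one] at h
  exact_mod_cast (sub_eq_zero.1 h.symm)

lemma card_negSupport_pos (hV : IsSymmetricReflexiveSystem V)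
    (hu : u ∈ Set.extremePoints ℝ (polarSet V)) (hb : Set.range b = tightSet V u)
    {v : Fin d → ℝ} (hv : v ∈ levelZero V u) : 0 < (negSupport b v).card := by
  by_contra! h0
  have h1 : negSupport b v = ∅ := Finset.card_eq_zero.1 (by omega)
  have h2 : negSupport b (-v) = ∅ :=
    Finset.card_eq_zero.1 (by rw [hV.card_negSupport_neg hu hb hv]; omega)
  have hv0 : v = 0 := b.ext_elem fun i => by
    rw [hV.repr_eq_ite_sub_ite hu hb hv i, h1, h2]
    simp
  exact hV.zero_notMem (hv0 ▸ hv.1)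

lemma sum_card_negSupport_le (hV : IsSymmetricReflexiveSystem V)
    (hu : u ∈ Set.extremePoints ℝ (polarSet V)) (hb : Set.range b = tightSet V u) :
    ∑ v ∈ (hV.finite_levelZero u).toFinset, (negSupport b v).card ≤ d := by
  rw [← Finset.card_biUnion]
  · exact (Finset.card_le_univ _).trans_eq (Fintype.card_fin d)
  · intro v hv w hw hvw
    rw [Set.Finite.coe_toFinset] at hv hw
    exact Finset.disjoint_left.2 fun i hi hi' => hvw (hV.negSupport_inj hu hb hv hw hi hi')

lemma ncard_levelZero_le (hV : IsSymmetricReflexiveSystem V)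
    (hu : u ∈ Set.extremePoints ℝ (polarSet V)) : (levelZero V u).ncard ≤ d := by
  obtain ⟨b, hb⟩ := hV.exists_basis hu
  refine le_trans ?_ (hV.sum_card_negSupport_le hu hb)
  rw [Set.ncard_eq_toFinset_card _ (hV.finite_levelZero u), Finset.card_eq_sum_ones]
  exact Finset.sum_le_sum fun v hv =>
    hV.card_negSupport_pos hu hb ((Set.Finite.mem_toFinset _).1 hv)

lemma card_negSupport_eq_one (hV : IsSymmetricReflexiveSystem V)
    (hu : u ∈ Set.extremePoints ℝ (polarSet V)) (hb : Set.range b = tightSet V u)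
    (hcard : d ≤ (levelZero V u).ncard + 1) {v : Fin d → ℝ} (hv : v ∈ levelZero V u) :
    (negSupport b v).card = 1 := by
  by_contra hne
  have h2 : 2 ≤ (negSupport b v).card := by
    have := hV.card_negSupport_pos hu hb hv
    omega
  have hle := hV.sum_card_negSupport_le hu hb
  rw [Set.ncard_eq_toFinset_card _ (hV.finite_levelZero u)] at hcard
  set L := (hV.finite_levelZero u).toFinset with hL
  have hmem : ∀ w, w ∈ L ↔ w ∈ levelZero V u := fun w => Set.Finite.mem_toFinset _
  have hsum : ∑ w ∈ L, (negSupport b w).card =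
      L.card + ∑ w ∈ L, ((negSupport b w).card - 1) := by
    rw [Finset.card_eq_sum_ones, ← Finset.sum_add_distrib]
    refine Finset.sum_congr rfl fun w hw => ?_
    have := hV.card_negSupport_pos hu hb ((hmem w).1 hw)
    omega
  have hpair : ∑ w ∈ {v, -v}, ((negSupport b w).card - 1) ≤
      ∑ w ∈ L, ((negSupport b w).card - 1) := by
    refine Finset.sum_le_sum_of_subset fun w hw => ?_
    rw [Finset.mem_insert, Finset.mem_singleton] at hw
    rcases hw with rfl | rfl
    · exact (hmem _).2 hv
    · exact (hmem _).2 (hV.neg_mem_levelZero hv)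
  rw [Finset.sum_pair (hV.ne_neg_of_mem hv.1), hV.card_negSupport_neg hu hb hv] at hpair
  omega

lemma exists_basis_mem_polarSet_iff (hV : IsSymmetricReflexiveSystem V)
    (hu : u ∈ Set.extremePoints ℝ (polarSet V)) {m : ℕ} (hd0 : 0 < d) (hm : 2 * m ≤ d)
    (hd : d ≤ 2 * m + 1)
    (hcard : V.ncard = 2 * d + 2 * m) :
    ∃ b : Module.Basis (Fin d) ℝ (Fin d → ℝ), (∀ i, IsLatticePoint (b i)) ∧
      (∀ i, IsLatticePoint (dualVec b i)) ∧
      ∀ y, y ∈ polarSet V ↔ dotEquiv b y ∈ hexBox hm := by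
  obtain ⟨b, hb⟩ := hV.exists_basis hu
  have hLcard : (levelZero V u).ncard = 2 * m := by
    have := hV.ncard_eq hu
    omega
  have : Nonempty (Fin d) := ⟨⟨0, hd0⟩⟩
  choose! ν hν using fun v (hv : v ∈ levelZero V u) =>
    Finset.card_eq_one.1 (hV.card_negSupport_eq_one hu hb (by omega) hv)
  have hνmem : ∀ v ∈ levelZero V u, ν v ∈ negSupport b v := fun v hv => by
    rw [hν v hv]
    exact Finset.mem_singleton_self _
  have hinj : Set.InjOn ν (levelZero V u) := fun v hv w hw h =>
    hV.negSupport_inj hu hb hv hw (hνmem v hv) (h ▸ hνmem w hw)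
  have hsub : ∀ v ∈ levelZero V u, b (ν (-v)) - b (ν v) = v := fun v hv =>
    b.ext_elem fun i => by
      rw [hV.repr_eq_ite_sub_ite hu hb hv i, hν v hv, hν _ (hV.neg_mem_levelZero hv)]
      simp [Finsupp.single_apply, eq_comm]
  have hdual_of_ne : ∀ i, (∃ v ∈ levelZero V u, ν v = i) → IsLatticePoint (dualVec b i) := by
    rintro _ ⟨v, hv, rfl⟩
    exact hV.isLatticePoint_dualVec hu hb hv (hνmem v hv)
  have hdual : ∀ i, IsLatticePoint (dualVec b i) := by
    intro i
    by_cases hi : ∃ v ∈ levelZero V u, ν v = i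
    · exact hdual_of_ne i hi
    have himg : ν '' levelZero V u = {i}ᶜ := by
      refine Set.eq_of_subset_of_ncard_le ?_ ?_ (Set.toFinite _)
      · rintro _ ⟨v, hv, rfl⟩ h
        exact hi ⟨v, hv, h⟩
      · rw [hinj.ncard_image, hLcard, Set.ncard_compl]
        simp
        omega
    have hsum : dualVec b i = u - ∑ j ∈ Finset.univ.erase i, dualVec b j := by
      rw [eq_sub_iff_add_eq, Finset.add_sum_erase _ _ (Finset.mem_univ i)]
      refine eq_of_forall_basis_dotProduct_eq b fun j => ?_
      simp [dotProduct_sum, basis_dotProduct hb, Finsupp.single_apply]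
    rw [hsum]
    refine (hV.polar_lattice u hu).sub (IsLatticePoint.sum _ _ fun j hj => hdual_of_ne j ?_)
    have : j ∈ ν '' levelZero V u := himg ▸ Finset.ne_of_mem_erase hj
    exact this
  have hfin := hV.finite_levelZero u
  have hmem : ∀ v, v ∈ hfin.toFinset ↔ v ∈ levelZero V u := fun v => hfin.mem_toFinset
  obtain ⟨σ, h, hhL, heven, hodd, hor⟩ := exists_perm_pairing hm hfin.toFinset
    (by rw [← Set.ncard_eq_toFinset_card _ hfin, hLcard]) ν (by rwa [hfin.coe_toFinset])
    (fun v hv => (hmem _).2 (hV.neg_mem_levelZero ((hmem v).1 hv)))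
    (fun v hv => hV.ne_neg_of_mem ((hmem v).1 hv).1)
  have hrepr : ∀ i, dualVec (b.reindex σ.symm) i = dualVec b (σ i) := fun i =>
    eq_of_forall_dotProduct_eq fun x => by simp
  have hpair : ∀ k y, dotEquiv (b.reindex σ.symm) y (evenIdx hm k) -
      dotEquiv (b.reindex σ.symm) y (oddIdx hm k) = h k ⬝ᵥ y := fun k y => by
    conv_rhs => rw [← hsub (h k) ((hmem _).1 (hhL k))]
    simp [heven, hodd]
  have habs : ∀ y, y ∈ polarSet V → ∀ v ∈ V, |v ⬝ᵥ y| ≤ 1 := fun y hy v hv => by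
    have := hy _ (hV.neg_mem v hv)
    rw [neg_dotProduct] at this
    exact abs_le.2 ⟨by linarith, hy v hv⟩
  refine ⟨b.reindex σ.symm, fun i => ?_, fun i => ?_,
    fun y => ⟨fun hy => ⟨fun i => ?_, fun k => ?_⟩,
    fun hy v hv => ?_⟩⟩
  · simpa using hV.lattice _ (basis_mem hb _)
  · rw [hrepr]
    exact hdual _
  · simpa using habs y hy _ (basis_mem hb (σ i))
  · rw [hpair]
    exact habs y hy _ ((hmem _).1 (hhL k)).1
  · have hbi : ∀ i, |b i ⬝ᵥ y| ≤ 1 := fun i => by simpa using hy.1 (σ.symm i)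
    have hhk : ∀ k, |h k ⬝ᵥ y| ≤ 1 := fun k => by
      rw [← hpair]
      exact hy.2 k
    rcases (hV.eq_union hu ▸ hv : v ∈ _) with (hv | hv) | hv
    · obtain ⟨i, rfl⟩ : v ∈ Set.range b := hb ▸ hv
      exact (abs_le.1 (hbi i)).2
    · obtain ⟨i, hi⟩ : -v ∈ Set.range b := hb ▸ hv
      have := (abs_le.1 (hbi i)).1
      rw [hi, neg_dotProduct] at this
      linarith
    · obtain ⟨k, rfl | rfl⟩ := hor v ((hmem v).2 hv)
      · exact (abs_le.1 (hhk k)).2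
      · have := (abs_le.1 (hhk k)).1
        rw [neg_dotProduct]
        linarith

end IsSymmetricReflexiveSystem

end Core

section Polytope

variable {d : ℕ} {P : Set (Fin d → ℝ)}

lemma IsLatticePolytope.isCompact (hP : IsLatticePolytope P) : IsCompact P := by
  obtain ⟨V, -, rfl⟩ := hP
  exact V.finite_toSet.isCompact_convexHull ℝ

lemma IsLatticePolytope.convex (hP : IsLatticePolytope P) : Convex ℝ P := by
  obtain ⟨V, -, rfl⟩ := hP
  exact convex_convexHull ℝ _

lemma IsLatticePolytope.finite_extremePoints (hP : IsLatticePolytope P) :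
    (Set.extremePoints ℝ P).Finite := by
  obtain ⟨V, -, rfl⟩ := hP
  exact V.finite_toSet.subset extremePoints_convexHull_subset

lemma IsLatticePolytope.isLatticePoint (hP : IsLatticePolytope P) {v : Fin d → ℝ}
    (hv : v ∈ Set.extremePoints ℝ P) : IsLatticePoint v := by
  obtain ⟨V, hV, rfl⟩ := hP
  exact hV v (extremePoints_convexHull_subset hv)

lemma IsLatticePolytope.convexHull_extremePoints (hP : IsLatticePolytope P) :
    convexHull ℝ (Set.extremePoints ℝ P) = P := by
  conv_rhs => rw [← closure_convexHull_extremePoints hP.isCompact hP.convex]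
  exact ((hP.finite_extremePoints.isCompact_convexHull ℝ).isClosed.closure_eq).symm

lemma neg_mem_of_eq_neg (hc : P = -P) {x : Fin d → ℝ} (hx : x ∈ P) : -x ∈ P := by
  rw [hc]
  simpa using hx

lemma neg_mem_extremePoints (hc : P = -P) {v : Fin d → ℝ} (hv : v ∈ Set.extremePoints ℝ P) :
    -v ∈ Set.extremePoints ℝ P := by
  refine mem_extremePoints_iff_left.2 ⟨neg_mem_of_eq_neg hc hv.1, fun x hx y hy hxy => ?_⟩
  have hseg : v ∈ openSegment ℝ (-x) (-y) := by
    obtain ⟨s, t, hs, ht, hst, h⟩ := hxy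
    exact ⟨s, t, hs, ht, hst, by rw [← neg_eq_iff_eq_neg.2 h.symm.symm]; module⟩
  rw [← (mem_extremePoints_iff_left.1 hv).2 _ (neg_mem_of_eq_neg hc hx) _
    (neg_mem_of_eq_neg hc hy) hseg, neg_neg]

lemma dualPolytope_eq_polarSet (hP : IsLatticePolytope P) (hc : P = -P) :
    dualPolytope P = polarSet (Set.extremePoints ℝ P) := by
  ext y
  refine ⟨fun hy v hv => ?_, fun hy x hx => ?_⟩
  · have := hy _ (neg_mem_of_eq_neg hc hv.1)
    rw [dotProd_eq_dotProduct, neg_dotProduct] at this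
    linarith
  · have hconv : Convex ℝ {x : Fin d → ℝ | x ⬝ᵥ y ≤ 1} :=
      convex_halfSpace_le ⟨fun a b => add_dotProduct a b y, fun c a => smul_dotProduct c a y⟩ 1
    have hmem : -x ∈ convexHull ℝ (Set.extremePoints ℝ P) :=
      hP.convexHull_extremePoints.symm ▸ neg_mem_of_eq_neg hc hx
    have h : (-x) ⬝ᵥ y ≤ 1 := convexHull_min (t := {x | x ⬝ᵥ y ≤ 1}) hy hconv hmem
    rw [neg_dotProduct] at h
    rw [dotProd_eq_dotProduct]
    linarith

/-- The bipolar theorem for lattice polytopes containing the origin. -/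
lemma mem_of_forall_dualPolytope (hP : IsLatticePolytope P) (h0 : (0 : Fin d → ℝ) ∈ P)
    {x : Fin d → ℝ} (hx : ∀ y ∈ dualPolytope P, -1 ≤ x ⬝ᵥ y) : x ∈ P := by
  by_contra hxP
  obtain ⟨f, c, hfx, hf⟩ :=
    geometric_hahn_banach_point_closed hP.convex hP.isCompact.isClosed hxP
  obtain ⟨y, hy⟩ := exists_dotProduct_eq_apply f.toLinearMap
  have hc : c < 0 := by simpa using hf 0 h0
  have hy' : ∀ z, z ⬝ᵥ y = f z := hy
  have hmem : (-c)⁻¹ • y ∈ dualPolytope P := fun z hz => by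
    rw [dotProd_eq_dotProduct, dotProduct_smul, hy', smul_eq_mul, inv_mul_eq_div,
      le_div_iff₀ (by linarith)]
    linarith [hf z hz]
  have := hx _ hmem
  rw [dotProduct_smul, hy', smul_eq_mul, inv_mul_eq_div, le_div_iff₀ (by linarith)] at this
  linarith

lemma IsSimplicial.dim_pos (hP : IsReflexive P) (hs : IsSimplicial P) : 0 < d := by
  rcases Nat.eq_zero_or_pos d with rfl | h
  · exfalso
    have h0 := interior_subset hP.2.1
    have hF : IsFacet P P := by
      refine ⟨⟨0, 0, fun x _ => by simp [dotProd], ?_⟩, ⟨0, h0⟩, ?_⟩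
      · ext x
        simp [dotProd]
      · have := (vectorSpan ℝ P).finrank_le
        simpa using this
    have hcard := hs P hF
    rw [Set.ncard_eq_zero hP.1.finite_extremePoints] at hcard
    exact (hP.1.isCompact.extremePoints_nonempty ⟨0, h0⟩).ne_empty hcard
  · exact h

lemma zero_notMem_extremePoints (hd : 0 < d) (hP : (0 : Fin d → ℝ) ∈ interior P)
    (hc : P = -P) : (0 : Fin d → ℝ) ∉ Set.extremePoints ℝ P := by
  intro h0
  have : Nonempty (Fin d) := ⟨⟨0, hd⟩⟩
  have hsub : P ⊆ {0} := fun x hx =>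
    (mem_extremePoints_iff_left.1 h0).2 x hx (-x) (neg_mem_of_eq_neg hc hx)
      ⟨1 / 2, 1 / 2, by norm_num, by norm_num, by norm_num, by module⟩
  have := interior_mono hsub hP
  rw [interior_singleton] at this
  exact this

lemma extremePoints_face {u : Fin d → ℝ} {c : ℝ} (hu : ∀ x ∈ P, u ⬝ᵥ x ≤ c) :
    Set.extremePoints ℝ {x ∈ P | u ⬝ᵥ x = c} = {x ∈ Set.extremePoints ℝ P | u ⬝ᵥ x = c} := by
  have hext : IsExtreme ℝ P {x ∈ P | u ⬝ᵥ x = c} :=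
    (isExtreme_iff ℝ _ _).2 ⟨fun x hx => hx.1, fun x hx y hy z hz hseg =>
      ⟨hx, eq_of_mem_openSegment_of_dotProduct_le (hu x hx) (hu y hy) hseg hz.2⟩⟩
  rw [hext.extremePoints_eq]
  ext x
  exact ⟨fun h => ⟨h.2, h.1.2⟩, fun h => ⟨⟨h.1.1, h.2⟩, h.1⟩⟩

lemma dotProduct_le_one_of_mem_polarSet (hP : IsLatticePolytope P) (hc : P = -P)
    {u : Fin d → ℝ} (hu : u ∈ polarSet (Set.extremePoints ℝ P)) {x : Fin d → ℝ} (hx : x ∈ P) :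
    u ⬝ᵥ x ≤ 1 := by
  have h1 : u ∈ dualPolytope P := dualPolytope_eq_polarSet hP hc ▸ hu
  have h2 := h1 _ (neg_mem_of_eq_neg hc hx)
  rw [dotProd_eq_dotProduct, neg_dotProduct, dotProduct_comm] at h2
  linarith

lemma isFacet_of_mem_extremePoints_polarSet (hd : 0 < d) (hP : IsLatticePolytope P)
    (hc : P = -P) {u : Fin d → ℝ}
    (hu : u ∈ Set.extremePoints ℝ (polarSet (Set.extremePoints ℝ P))) :
    IsFacet P {x ∈ P | u ⬝ᵥ x = 1} := by
  set F := {x ∈ P | u ⬝ᵥ x = 1} with hF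
  have hspan := span_tightSet hP.finite_extremePoints hu
  have : Nonempty (Fin d) := ⟨⟨0, hd⟩⟩
  have hTF : tightSet (Set.extremePoints ℝ P) u ⊆ F := fun v hv =>
    ⟨hv.1.1, by rw [dotProduct_comm, hv.2]⟩
  have hTne : (tightSet (Set.extremePoints ℝ P) u).Nonempty := by
    rw [Set.nonempty_iff_ne_empty]
    intro h
    rw [h, Submodule.span_empty] at hspan
    exact bot_ne_top hspan
  obtain ⟨x₀, hx₀⟩ := hTne
  refine ⟨⟨u, 1, fun x hx => dotProduct_le_one_of_mem_polarSet hP hc hu.1 hx, rfl⟩,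
    ⟨x₀, hTF hx₀⟩, ?_⟩
  have hker : ∀ x ∈ vectorSpan ℝ F, x ⬝ᵥ u = 0 := by
    intro x hx
    refine Submodule.span_induction (p := fun x _ => x ⬝ᵥ u = 0) ?_ (zero_dotProduct u)
      (fun a b _ _ ha hb => by rw [add_dotProduct, ha, hb, add_zero])
      (fun c a _ ha => by rw [smul_dotProduct, ha, smul_zero]) hx
    rintro _ ⟨a, ha, b, hb, rfl⟩
    simp only [vsub_eq_sub]
    rw [sub_dotProduct, dotProduct_comm a, dotProduct_comm b, ha.2, hb.2, sub_self]
  have h1 := Submodule.finrank_lt (s := vectorSpan ℝ F) fun h => by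
    have h1 := hker x₀ (h ▸ Submodule.mem_top)
    rw [hx₀.2] at h1
    exact one_ne_zero h1
  have hsup : Submodule.span ℝ {x₀} ⊔ vectorSpan ℝ F = ⊤ := by
    rw [eq_top_iff, ← hspan, Submodule.span_le]
    intro v hv
    have h3 : v - x₀ ∈ vectorSpan ℝ F := vsub_mem_vectorSpan ℝ (hTF hv) (hTF hx₀)
    have h4 := Submodule.add_mem_sup (Submodule.mem_span_singleton_self (R := ℝ) x₀) h3
    rwa [add_sub_cancel] at h4
  have h2 := Submodule.finrank_add_le_finrank_add_finrank (Submodule.span ℝ {x₀}) (vectorSpan ℝ F)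
  have h3 : Module.finrank ℝ (Submodule.span ℝ {x₀}) ≤ 1 := by
    simpa using finrank_span_le_card (R := ℝ) ({x₀} : Set (Fin d → ℝ))
  rw [hsup, finrank_top] at h2
  rw [Module.finrank_fin_fun] at h1 h2
  omega

lemma IsReflexive.isSymmetricReflexiveSystem (hP : IsReflexive P) (hs : IsSimplicial P)
    (hc : P = -P) : IsSymmetricReflexiveSystem (Set.extremePoints ℝ P) where
  finite := hP.1.finite_extremePoints
  neg_mem _ hv := neg_mem_extremePoints hc hv
  zero_notMem := zero_notMem_extremePoints (hs.dim_pos hP) hP.2.1 hc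
  lattice _ hv := hP.1.isLatticePoint hv
  polar_lattice u hu := hP.2.2.isLatticePoint (by rwa [dualPolytope_eq_polarSet hP.1 hc])
  simplicial u hu := by
    have hF := isFacet_of_mem_extremePoints_polarSet (hs.dim_pos hP) hP.1 hc hu
    have hcard := hs _ hF
    rw [extremePoints_face] at hcard
    · simpa only [tightSet, dotProduct_comm u] using hcard
    · exact fun x hx => dotProduct_le_one_of_mem_polarSet hP.1 hc hu.1 hx

lemma IsReflexive.exists_mem_extremePoints_polarSet (hP : IsReflexive P) (hc : P = -P) :
    (Set.extremePoints ℝ (polarSet (Set.extremePoints ℝ P))).Nonempty := by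
  rw [← dualPolytope_eq_polarSet hP.1 hc]
  exact hP.2.2.isCompact.extremePoints_nonempty ⟨0, fun x _ => by simp [dotProd]⟩

end Polytope

section HexBox

variable {m d : ℕ}

lemma neg_mem_hexBox {hm : 2 * m ≤ d} {z : Fin d → ℝ} (hz : z ∈ hexBox hm) :
    -z ∈ hexBox hm := by
  refine ⟨fun i => by simpa using hz.1 i, fun k => ?_⟩
  have := hz.2 k
  rw [abs_sub_comm] at this
  simpa [sub_eq_neg_add, add_comm] using this

lemma evenIdx_ne_oddIdx (hm : 2 * m ≤ d) (k l : Fin m) : evenIdx hm k ≠ oddIdx hm l := by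
  simp only [evenIdx, oddIdx, ne_eq, Fin.mk.injEq]
  omega

lemma evenIdx_injective (hm : 2 * m ≤ d) : Function.Injective (evenIdx hm) := by
  intro k l h
  simp only [evenIdx, Fin.mk.injEq] at h
  omega

lemma oddIdx_injective (hm : 2 * m ≤ d) : Function.Injective (oddIdx hm) := by
  intro k l h
  simp only [oddIdx, Fin.mk.injEq] at h
  omega

/-- The inequality `-1 ≤ a ⬝ᵥ z` is valid on `K`, and it is the only valid one that is tight at
some point of `K`. -/
def IsExposedInequality (K : Set (Fin d → ℝ)) (a : Fin d → ℝ) : Prop :=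
  (∀ z ∈ K, -1 ≤ a ⬝ᵥ z) ∧ ∃ z₀ ∈ K, a ⬝ᵥ z₀ = -1 ∧
    ∀ a' : Fin d → ℝ, (∀ z ∈ K, -1 ≤ a' ⬝ᵥ z) → a' ⬝ᵥ z₀ = -1 → a' = a

lemma IsExposedInequality.neg {K : Set (Fin d → ℝ)} {a : Fin d → ℝ} (hK : ∀ z ∈ K, -z ∈ K)
    (ha : IsExposedInequality K a) : IsExposedInequality K (-a) := by
  obtain ⟨h1, z₀, hz₀, h2, h3⟩ := ha
  have hneg : ∀ a' : Fin d → ℝ, (∀ z ∈ K, -1 ≤ a' ⬝ᵥ z) → ∀ z ∈ K, -1 ≤ (-a') ⬝ᵥ z :=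
    fun a' ha' z hz => by simpa using ha' _ (hK z hz)
  refine ⟨hneg a h1, -z₀, hK _ hz₀, by simpa using h2, fun a' ha' h => ?_⟩
  rw [← h3 (-a') (hneg a' ha') (by simpa using h), neg_neg]

lemma dotProduct_eq_zero_of_add_sub_mem {K : Set (Fin d → ℝ)} {a z w : Fin d → ℝ}
    (ha : ∀ z ∈ K, -1 ≤ a ⬝ᵥ z) (hz : a ⬝ᵥ z = -1) (h1 : z + w ∈ K) (h2 : z - w ∈ K) :
    a ⬝ᵥ w = 0 := by
  have h3 := ha _ h1
  have h4 := ha _ h2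
  rw [dotProduct_add, hz] at h3
  rw [dotProduct_sub, hz] at h4
  linarith

lemma isExposedInequality_single (hm : 2 * m ≤ d) (i : Fin d) :
    IsExposedInequality (hexBox hm) (Pi.single i 1) := by
  set z₀ : Fin d → ℝ := fun j => if j = i then -1 else -1 / 2 with hz₀
  have hmem : ∀ t : ℝ, |t| ≤ 1 / 2 → ∀ j, j ≠ i → z₀ + Pi.single j t ∈ hexBox hm := by
    intro t ht j hj
    rw [abs_le] at ht
    refine ⟨fun l => ?_, fun k => ?_⟩
    · simp only [hz₀, Pi.add_apply, Pi.single_apply, abs_le]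
      split_ifs with h1 h2
      · exact absurd (h2 ▸ h1) hj
      all_goals constructor <;> linarith
    · have hne := evenIdx_ne_oddIdx hm k k
      generalize evenIdx hm k = e at hne
      generalize oddIdx hm k = o at hne
      simp only [hz₀, Pi.add_apply, Pi.single_apply, abs_le]
      split_ifs <;> constructor <;> linarith
  have hmem₀ : z₀ ∈ hexBox hm := by
    refine ⟨fun l => ?_, fun k => ?_⟩ <;> simp only [hz₀, abs_le] <;> split_ifs <;> norm_num
  refine ⟨fun z hz => by simpa using (abs_le.1 (hz.1 i)).1, z₀, hmem₀, by simp [hz₀],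
    fun a ha haz => ?_⟩
  have hzero : ∀ j, j ≠ i → a j = 0 := fun j hj => by
    have h1 := hmem (1 / 2) (by norm_num [abs_le]) j hj
    have h2 := hmem (-(1 / 2)) (by norm_num [abs_le]) j hj
    rw [Pi.single_neg, ← sub_eq_add_neg] at h2
    have := dotProduct_eq_zero_of_add_sub_mem ha haz h1 h2
    simpa using this
  have hi : a i = 1 := by
    rw [dotProduct, Finset.sum_eq_single i (fun j _ hj => by rw [hzero j hj, zero_mul])
      (by simp)] at haz
    simp [hz₀] at haz
    linarith
  ext j
  by_cases hj : j = i
  · rw [hj, hi, Pi.single_eq_same]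
  · rw [hzero j hj, Pi.single_eq_of_ne hj]

lemma isExposedInequality_single_sub_single (hm : 2 * m ≤ d) (k : Fin m) :
    IsExposedInequality (hexBox hm) (Pi.single (evenIdx hm k) 1 - Pi.single (oddIdx hm k) 1) := by
  have hne := evenIdx_ne_oddIdx hm k k
  set z₀ : Fin d → ℝ := Pi.single (oddIdx hm k) (1 / 2) - Pi.single (evenIdx hm k) (1 / 2) with hz₀
  have hmem : ∀ t : ℝ, |t| ≤ 1 / 2 → ∀ j, j ≠ evenIdx hm k → j ≠ oddIdx hm k →
      z₀ + Pi.single j t ∈ hexBox hm := by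
    intro t ht j hje hjo
    rw [abs_le] at ht
    refine ⟨fun l => ?_, fun l => ?_⟩
    · simp only [hz₀, Pi.add_apply, Pi.sub_apply, Pi.single_apply, abs_le]
      split_ifs <;> constructor <;> linarith
    · by_cases hl : l = k
      · subst hl
        simp only [hz₀, Pi.add_apply, Pi.sub_apply, Pi.single_apply, abs_le, hne, hne.symm,
          hje.symm, hjo.symm, if_true, if_false]
        norm_num
      · have h1 : evenIdx hm l ≠ evenIdx hm k := fun h => hl (evenIdx_injective hm h)
        have h2 : oddIdx hm l ≠ oddIdx hm k := fun h => hl (oddIdx_injective hm h)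
        simp only [hz₀, Pi.add_apply, Pi.sub_apply, Pi.single_apply, abs_le, h1, h2,
          evenIdx_ne_oddIdx hm l k, (evenIdx_ne_oddIdx hm k l).symm, if_false]
        split_ifs <;> constructor <;> linarith
  have hmem' : ∀ t : ℝ, |t| ≤ 1 / 2 →
      z₀ + (Pi.single (evenIdx hm k) t + Pi.single (oddIdx hm k) t) ∈ hexBox hm := by
    intro t ht
    rw [abs_le] at ht
    refine ⟨fun l => ?_, fun l => ?_⟩
    · simp only [hz₀, Pi.add_apply, Pi.sub_apply, Pi.single_apply, abs_le]
      split_ifs <;> constructor <;> linarith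
    · by_cases hl : l = k
      · subst hl
        simp only [hz₀, Pi.add_apply, Pi.sub_apply, Pi.single_apply, abs_le, hne, hne.symm,
          if_true, if_false]
        constructor <;> linarith
      · have h1 : evenIdx hm l ≠ evenIdx hm k := fun h => hl (evenIdx_injective hm h)
        have h2 : oddIdx hm l ≠ oddIdx hm k := fun h => hl (oddIdx_injective hm h)
        simp only [hz₀, Pi.add_apply, Pi.sub_apply, Pi.single_apply, abs_le, h1, h2,
          evenIdx_ne_oddIdx hm l k, (evenIdx_ne_oddIdx hm k l).symm, if_false]
        norm_num
  refine ⟨fun z hz => by simpa [sub_dotProduct] using (abs_le.1 (hz.2 k)).1, z₀,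
    by simpa using hmem' 0 (by norm_num), ?_, fun a ha haz => ?_⟩
  · simp [hz₀, hne, hne.symm]
    norm_num
  have hzero : ∀ j, j ≠ evenIdx hm k → j ≠ oddIdx hm k → a j = 0 := fun j hje hjo => by
    have h1 := hmem (1 / 2) (by norm_num [abs_le]) j hje hjo
    have h2 := hmem (-(1 / 2)) (by norm_num [abs_le]) j hje hjo
    rw [Pi.single_neg, ← sub_eq_add_neg] at h2
    have := dotProduct_eq_zero_of_add_sub_mem ha haz h1 h2
    simpa using this
  have h1 := hmem' (1 / 2) (by norm_num [abs_le])
  have h2 := hmem' (-(1 / 2)) (by norm_num [abs_le])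
  rw [Pi.single_neg, Pi.single_neg, ← neg_add, ← sub_eq_add_neg] at h2
  have h3 := dotProduct_eq_zero_of_add_sub_mem ha haz h1 h2
  simp only [hz₀, dotProduct_sub, dotProduct_add, dotProduct_single] at h3 haz
  ext j
  by_cases hje : j = evenIdx hm k
  · subst hje
    simp [hne]
    linarith
  by_cases hjo : j = oddIdx hm k
  · subst hjo
    simp [hne.symm]
    linarith
  simp [hzero j hje hjo, hje, hjo]

/-- The inward normals of the facets of `hexBox hm`. -/
def hexBoxNormal (hm : 2 * m ≤ d) : (Fin d ⊕ Fin m) ⊕ (Fin d ⊕ Fin m) → (Fin d → ℝ)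
  | .inl (.inl i) => Pi.single i 1
  | .inl (.inr k) => Pi.single (evenIdx hm k) 1 - Pi.single (oddIdx hm k) 1
  | .inr (.inl i) => -Pi.single i 1
  | .inr (.inr k) => -(Pi.single (evenIdx hm k) 1 - Pi.single (oddIdx hm k) 1)

lemma isExposedInequality_hexBoxNormal (hm : 2 * m ≤ d) :
    ∀ c, IsExposedInequality (hexBox hm) (hexBoxNormal hm c)
  | .inl (.inl i) => isExposedInequality_single hm i
  | .inl (.inr k) => isExposedInequality_single_sub_single hm k
  | .inr (.inl i) => (isExposedInequality_single hm i).neg fun _ => neg_mem_hexBox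
  | .inr (.inr k) => (isExposedInequality_single_sub_single hm k).neg fun _ => neg_mem_hexBox

lemma hexBoxNormal_injective (hm : 2 * m ≤ d) : Function.Injective (hexBoxNormal hm) := by
  have hpair : ∀ k l : Fin m, (Pi.single (evenIdx hm k) 1 - Pi.single (oddIdx hm k) 1 : Fin d → ℝ)
      (evenIdx hm l) = if l = k then 1 else 0 := fun k l => by
    simp [Pi.single_apply, (evenIdx_injective hm).eq_iff, evenIdx_ne_oddIdx hm l k]
  have hsingle : ∀ i j : Fin d, (Pi.single i 1 : Fin d → ℝ) = Pi.single j 1 → i = j :=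
    fun i j h => by
      have := congrFun h i
      by_contra hij
      simp [hij] at this
  have hpair_inj : ∀ k l : Fin m,
      (Pi.single (evenIdx hm k) 1 - Pi.single (oddIdx hm k) 1 : Fin d → ℝ) =
        Pi.single (evenIdx hm l) 1 - Pi.single (oddIdx hm l) 1 → k = l := fun k l h => by
    have := congrFun h (evenIdx hm k)
    rw [hpair, hpair] at this
    by_contra hkl
    simp [hkl] at this
  have hpair_neg : ∀ k l : Fin m,
      (Pi.single (evenIdx hm k) 1 - Pi.single (oddIdx hm k) 1 : Fin d → ℝ) ≠
        -(Pi.single (evenIdx hm l) 1 - Pi.single (oddIdx hm l) 1) := fun k l h => by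
    have := congrFun h (evenIdx hm k)
    rw [Pi.neg_apply, hpair, hpair, if_pos rfl] at this
    split_ifs at this <;> norm_num at this
  intro c c' h
  have hsum := congrArg (fun x : Fin d → ℝ => ∑ i, x i) h
  rcases c with (i | k) | (i | k) <;> rcases c' with (j | l) | (j | l) <;>
    simp only [hexBoxNormal, Pi.neg_apply, Pi.sub_apply, Finset.sum_neg_distrib,
      Finset.sum_sub_distrib, Finset.sum_pi_single', Finset.mem_univ, if_true] at h hsum <;>
    first
    | (exfalso; norm_num at hsum; done)
    | rw [hsingle _ _ h]
    | rw [hpair_inj _ _ h]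
    | rw [hsingle _ _ (neg_injective h)]
    | rw [hpair_inj _ _ (neg_injective h)]
    | exact absurd h (hpair_neg _ _)
    | exact absurd h.symm (hpair_neg _ _)

lemma exists_mem_extremePoints_of_isExposedInequality {P K : Set (Fin d → ℝ)}
    (hP : IsLatticePolytope P) (h0 : (0 : Fin d → ℝ) ∈ P) (f : (Fin d → ℝ) ≃ₗ[ℝ] (Fin d → ℝ))
    (hf : f '' dualPolytope P = K) {a : Fin d → ℝ} (ha : IsExposedInequality K a) :
    ∃ x ∈ Set.extremePoints ℝ P, ∀ z, x ⬝ᵥ f.symm z = a ⬝ᵥ z := by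
  obtain ⟨h1, z₀, hz₀, h2, h3⟩ := ha
  obtain ⟨x, hx⟩ := exists_dotProduct_eq_apply ((dotProductBilin ℝ ℝ a).comp f.toLinearMap)
  have hx' : ∀ z, x ⬝ᵥ f.symm z = a ⬝ᵥ z := fun z => by
    rw [dotProduct_comm, hx]
    simp
  have hxP : x ∈ P := mem_of_forall_dualPolytope hP h0 fun y hy => by
    have := h1 (f y) (hf ▸ Set.mem_image_of_mem f hy)
    rwa [← hx', f.symm_apply_apply] at this
  have hdual : ∀ p ∈ P, ∀ z ∈ K, -1 ≤ p ⬝ᵥ f.symm z := by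
    intro p hp z hz
    rw [← hf] at hz
    obtain ⟨y, hy, rfl⟩ := hz
    rw [f.symm_apply_apply]
    exact hy p hp
  refine ⟨x, mem_extremePoints_iff_left.2 ⟨hxP, fun p hp q hq hseg => ?_⟩, hx'⟩
  have htight : -p ⬝ᵥ f.symm z₀ = 1 := by
    have hle : ∀ r ∈ P, (-f.symm z₀) ⬝ᵥ r ≤ 1 := fun r hr => by
      have := hdual r hr z₀ hz₀
      rw [neg_dotProduct, dotProduct_comm]
      linarith
    have := eq_of_mem_openSegment_of_dotProduct_le (hle p hp) (hle q hq) hseg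
      (by rw [neg_dotProduct, dotProduct_comm, hx', h2, neg_neg])
    rwa [neg_dotProduct, dotProduct_comm, ← neg_dotProduct] at this
  rw [neg_dotProduct] at htight
  obtain ⟨p', hp'⟩ := exists_dotProduct_eq_apply
    ((dotProductBilin ℝ ℝ p).comp f.symm.toLinearMap)
  have hp'' : ∀ z, p' ⬝ᵥ z = p ⬝ᵥ f.symm z := fun z => by
    rw [dotProduct_comm, hp']
    simp
  have hpa : p' = a := h3 p' (fun z hz => by
    rw [hp'']
    exact hdual p hp z hz) (by rw [hp'']; linarith)
  refine dotProduct_eq _ _ fun y => ?_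
  rw [← f.symm_apply_apply y, ← hp'', hx', hpa]

lemma two_mul_add_le_ncard_extremePoints {P : Set (Fin d → ℝ)} (hP : IsLatticePolytope P)
    (h0 : (0 : Fin d → ℝ) ∈ P) (hm : 2 * m ≤ d)
    (h : LatticeEquivTo (dualPolytope P) (hexBox hm)) :
    2 * d + 2 * m ≤ (Set.extremePoints ℝ P).ncard := by
  obtain ⟨f, -, hf⟩ := h
  choose x hx hxf using fun c => exists_mem_extremePoints_of_isExposedInequality hP h0 f hf
    (isExposedInequality_hexBoxNormal hm c)
  have hinj : Function.Injective x := fun c c' hcc => hexBoxNormal_injective hm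
    (dotProduct_eq _ _ fun z => by rw [← hxf, ← hxf, hcc])
  have hle := Set.ncard_le_ncard (Set.range_subset_iff.2 hx) hP.finite_extremePoints
  rw [← Set.image_univ, Set.ncard_image_of_injective _ hinj, Set.ncard_univ] at hle
  simp only [Nat.card_eq_fintype_card, Fintype.card_sum, Fintype.card_fin] at hle
  omega

end HexBox

section Hexagon

lemma convex_abs_sub_le_one :
    Convex ℝ {x : Fin 2 → ℝ | |x 0| ≤ 1 ∧ |x 1| ≤ 1 ∧ |x 0 - x 1| ≤ 1} := by
  intro x hx y hy s t hs ht hst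
  obtain ⟨hx0, hx1, hx2⟩ := hx
  obtain ⟨hy0, hy1, hy2⟩ := hy
  rw [abs_le] at hx0 hx1 hx2 hy0 hy1 hy2
  obtain rfl : t = 1 - s := by linarith
  simp only [Set.mem_ofPred_eq, Pi.add_apply, Pi.smul_apply, smul_eq_mul, abs_le]
  refine ⟨⟨?_, ?_⟩, ⟨?_, ?_⟩, ⟨?_, ?_⟩⟩ <;> nlinarith

lemma smul_add_smul_mem_Z2 {p q : Fin 2 → ℝ} (hp : p ∈ Z2) (hq : q ∈ Z2) {s t : ℝ}
    (hs : 0 ≤ s) (ht : 0 ≤ t) (hst : s + t ≤ 1) : s • p + t • q ∈ Z2 := by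
  have hconv : Convex ℝ Z2 := convex_convexHull ℝ _
  have h1 : (![1, 0] : Fin 2 → ℝ) ∈ Z2 := subset_convexHull ℝ _ (by simp)
  have h2 : (![-1, 0] : Fin 2 → ℝ) ∈ Z2 := subset_convexHull ℝ _ (by simp)
  have h0 : (0 : Fin 2 → ℝ) ∈ Z2 := by
    convert hconv h1 h2 (a := 1 / 2) (b := 1 / 2) (by norm_num) (by norm_num) (by norm_num) using 1
    ext i
    fin_cases i <;> simp
  rcases (add_nonneg hs ht).eq_or_lt with h | h
  · obtain rfl : s = 0 := by linarith
    obtain rfl : t = 0 := by linarith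
    simpa using h0
  · have h3 := hconv hp hq (a := s / (s + t)) (b := t / (s + t)) (by positivity) (by positivity)
      (by field_simp)
    have h4 := hconv h3 h0 h.le (sub_nonneg.2 hst) (by ring)
    convert h4 using 1
    rw [smul_zero, add_zero, smul_add, smul_smul, smul_smul, mul_div_cancel₀ _ h.ne',
      mul_div_cancel₀ _ h.ne']

lemma mem_Z2_iff {x : Fin 2 → ℝ} : x ∈ Z2 ↔ |x 0| ≤ 1 ∧ |x 1| ≤ 1 ∧ |x 0 - x 1| ≤ 1 := by
  constructor
  · refine fun hx => convexHull_min ?_ convex_abs_sub_le_one hx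
    intro y hy
    simp only [Set.mem_insert_iff, Set.mem_singleton_iff] at hy
    rcases hy with rfl | rfl | rfl | rfl | rfl | rfl <;> simp
  · rintro ⟨h0, h1, h2⟩
    rw [abs_le] at h0 h1 h2
    have hmem : ∀ p ∈ ({![1,0], ![0,1], ![1,1], ![-1,0], ![0,-1], ![-1,-1]} : Set (Fin 2 → ℝ)),
        p ∈ Z2 := fun p hp => subset_convexHull ℝ _ hp
    have key : ∀ p ∈ ({![1,0], ![0,1], ![1,1], ![-1,0], ![0,-1], ![-1,-1]} : Set (Fin 2 → ℝ)),
        ∀ q ∈ ({![1,0], ![0,1], ![1,1], ![-1,0], ![0,-1], ![-1,-1]} : Set (Fin 2 → ℝ)),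
        ∀ s t : ℝ, 0 ≤ s → 0 ≤ t → s + t ≤ 1 → x 0 = s * p 0 + t * q 0 →
          x 1 = s * p 1 + t * q 1 → x ∈ Z2 := by
      intro p hp q hq s t hs ht hst hx0 hx1
      convert smul_add_smul_mem_Z2 (hmem p hp) (hmem q hq) hs ht hst using 1
      ext i
      fin_cases i
      · simpa using hx0
      · simpa using hx1
    rcases le_total 0 (x 0) with hx | hx <;> rcases le_total 0 (x 1) with hy | hy
    · rcases le_total (x 0) (x 1) with h | h
      · exact key ![1,1] (by simp) ![0,1] (by simp) (x 0) (x 1 - x 0) hx (by linarith)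
          (by linarith) (by simp) (by simp)
      · exact key ![1,1] (by simp) ![1,0] (by simp) (x 1) (x 0 - x 1) hy (by linarith)
          (by linarith) (by simp) (by simp)
    · exact key ![1,0] (by simp) ![0,-1] (by simp) (x 0) (-x 1) hx (by linarith)
        (by linarith) (by simp) (by simp)
    · exact key ![-1,0] (by simp) ![0,1] (by simp) (-x 0) (x 1) (by linarith) hy
        (by linarith) (by simp) (by simp)
    · rcases le_total (x 0) (x 1) with h | h
      · exact key ![-1,-1] (by simp) ![-1,0] (by simp) (-x 1) (x 1 - x 0) (by linarith)
          (by linarith) (by linarith) (by simp) (by simp)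
      · exact key ![-1,-1] (by simp) ![0,-1] (by simp) (-x 0) (x 0 - x 1) (by linarith)
          (by linarith) (by linarith) (by simp) (by simp)

lemma prodZ2_eq_hexBox (m : ℕ) : prodZ2 m = hexBox (le_refl (2 * m)) := by
  ext x
  simp only [prodZ2, hexBox, mem_Z2_iff, Set.mem_ofPred_eq]
  refine ⟨fun h => ⟨fun i => ?_, fun k => (h k).2.2⟩,
    fun h k => ⟨h.1 _, h.1 _, h.2 k⟩⟩
  have hk := h ⟨i / 2, by omega⟩
  rcases Nat.mod_two_eq_zero_or_one i with hi | hi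
  · have e : x i = pairCoords x ⟨i / 2, by omega⟩ 0 :=
      congrArg x (Fin.ext (show (i : ℕ) = 2 * (i / 2) + 0 by omega))
    rw [e]
    exact hk.1
  · have e : x i = pairCoords x ⟨i / 2, by omega⟩ 1 :=
      congrArg x (Fin.ext (show (i : ℕ) = 2 * (i / 2) + 1 by omega))
    rw [e]
    exact hk.2.1

lemma boxProdZ2_eq_hexBox (m : ℕ) : boxProdZ2 m = hexBox (Nat.le_succ (2 * m)) := by
  ext x
  simp only [boxProdZ2, hexBox, mem_Z2_iff, Set.mem_ofPred_eq]
  refine ⟨fun ⟨h', h⟩ => ⟨fun i => ?_, fun k => (h k).2.2⟩,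
    fun h => ⟨abs_le.1 (h.1 _), fun k => ⟨h.1 _, h.1 _, h.2 k⟩⟩⟩
  rcases Nat.lt_succ_iff_lt_or_eq.1 i.2 with hlt | heq
  · have hk := h ⟨i / 2, by omega⟩
    rcases Nat.mod_two_eq_zero_or_one i with hi | hi
    · have e : x i = pairCoords' x ⟨i / 2, by omega⟩ 0 :=
        congrArg x (Fin.ext (show (i : ℕ) = 2 * (i / 2) + 0 by omega))
      rw [e]
      exact hk.1
    · have e : x i = pairCoords' x ⟨i / 2, by omega⟩ 1 :=
        congrArg x (Fin.ext (show (i : ℕ) = 2 * (i / 2) + 1 by omega))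
      rw [e]
      exact hk.2.1
  · rw [show i = ⟨2 * m, by omega⟩ from Fin.ext heq]
    exact abs_le.2 h'

end Hexagon

section VertexBound

variable {d : ℕ} {P : Set (Fin d → ℝ)}

lemma ncard_extremePoints_le (hP : IsReflexive P) (hs : IsSimplicial P) (hc : P = -P) {m : ℕ}
    (hd : d ≤ 2 * m + 1) : (Set.extremePoints ℝ P).ncard ≤ 2 * d + 2 * m := by
  have hV := hP.isSymmetricReflexiveSystem hs hc
  obtain ⟨u, hu⟩ := hP.exists_mem_extremePoints_polarSet hc
  have h1 := hV.ncard_eq hu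
  obtain ⟨k, hk⟩ := hV.even_ncard_levelZero u
  have h2 := hV.ncard_levelZero_le hu
  omega

lemma ncard_extremePoints_eq_iff (hP : IsReflexive P) (hs : IsSimplicial P) (hc : P = -P) {m : ℕ}
    (hm : 2 * m ≤ d) (hd : d ≤ 2 * m + 1) :
    (Set.extremePoints ℝ P).ncard = 2 * d + 2 * m ↔
      LatticeEquivTo (dualPolytope P) (hexBox hm) := by
  refine ⟨fun hcard => ?_, fun h => le_antisymm (ncard_extremePoints_le hP hs hc hd)
    (two_mul_add_le_ncard_extremePoints hP.1 (interior_subset hP.2.1) hm h)⟩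
  obtain ⟨u, hu⟩ := hP.exists_mem_extremePoints_polarSet hc
  obtain ⟨b, hb, hb', h⟩ := (hP.isSymmetricReflexiveSystem hs hc).exists_basis_mem_polarSet_iff hu
    (hs.dim_pos hP) hm hd hcard
  refine ⟨dotEquiv b, isLatticePoint_dotEquiv_iff b hb hb', ?_⟩
  rw [dualPolytope_eq_polarSet hP.1 hc]
  ext z
  refine ⟨?_, fun hz => ⟨(dotEquiv b).symm z, (h _).2 ?_, (dotEquiv b).apply_symm_apply z⟩⟩
  · rintro ⟨y, hy, rfl⟩
    exact (h y).1 hy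
  · rwa [(dotEquiv b).apply_symm_apply]

end VertexBound

/-- For a centrally symmetric simplicial reflexive polytope `P ⊆ ℝ^d`:
if `d` is even then `|V(P)| ≤ 3d` with equality iff `P*` is unimodularly equivalent to the
`(d/2)`-fold product `Z₂ × ⋯ × Z₂`; if `d` is odd then `|V(P)| ≤ 3d - 1` with equality iff
`P*` is unimodularly equivalent to `[-1,1] × Z₂ × ⋯ × Z₂` with `(d-1)/2` hexagon factors. -/
theorem centrally_symmetric_vertex_bound {d : ℕ} (P : Set (Fin d → ℝ)) (hP : IsReflexive P)
    (hs : IsSimplicial P) (hc : P = -P) :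
    (Even d → (Set.extremePoints ℝ P).ncard ≤ 3 * d ∧
      ∀ m : ℕ, d = 2 * m →
        ((Set.extremePoints ℝ P).ncard = 3 * d ↔
          LatticeEquivTo (dualPolytope P) (prodZ2 m))) ∧
    (Odd d → (Set.extremePoints ℝ P).ncard ≤ 3 * d - 1 ∧
      ∀ m : ℕ, d = 2 * m + 1 →
        ((Set.extremePoints ℝ P).ncard = 3 * d - 1 ↔
          LatticeEquivTo (dualPolytope P) (boxProdZ2 m))) := by
  refine ⟨fun ⟨k, hk⟩ => ⟨?_, ?_⟩, fun ⟨k, hk⟩ => ⟨?_, ?_⟩⟩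
  · have := ncard_extremePoints_le hP hs hc (m := k) (by omega)
    omega
  · rintro m rfl
    rw [prodZ2_eq_hexBox, ← ncard_extremePoints_eq_iff hP hs hc le_rfl (Nat.le_succ _)]
    omega
  · have := ncard_extremePoints_le hP hs hc (m := k) (by omega)
    omega
  · rintro m rfl
    rw [boxProdZ2_eq_hexBox, ← ncard_extremePoints_eq_iff hP hs hc (Nat.le_succ _) le_rfl]
    omega

end
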